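/- arXiv:1706.03512 — 2 statements merged into one kernel-verified Lean document; each statement's English description precedes it below -/
import Mathlib

section
/- Let $\mathfrak{g}_0$ be a real Lie algebra and $\mathfrak{l}_0$ an $\mathbb{R}$-linear subspace of finite codimension that generates $\mathfrak{g}_0$ as a Lie algebra, with canonical descending chain $(F_h)_{h\in\mathbb{Z}}$. Then for every $h\ge 0$, the subspace $F_h$ is a Lie subalgebra of $\mathfrak{g}_0$ (i.e., $[F_h,F_h]\subseteq F_h$). -/
/-- The linear span of brackets `⁅x, y⁆` with `x ∈ A`, `y ∈ B`. -/
def bracketSpan {G : Type*} [LieRing G] [LieAlgebra ℝ G] (A B : Submodule ℝ G) :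
    Submodule ℝ G :=
  Submodule.span ℝ {z : G | ∃ x ∈ A, ∃ y ∈ B, z = ⁅x, y⁆}

/-- `F` is the canonical descending chain associated to the pair `(𝔤₀, 𝔩₀)`:
`F (-1) = 𝔩₀`, `F h = F (h+1) + [F (h+1), F (-1)]` for `h < -1`, and
`F h = {X ∈ F (-1) ∣ [X, F (-1)] ⊆ F (h-1)}` for `h ≥ 0`. -/
def IsCanonicalChain {G : Type*} [LieRing G] [LieAlgebra ℝ G]
    (l₀ : Submodule ℝ G) (F : ℤ → Submodule ℝ G) : Prop :=
  F (-1) = l₀ ∧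
  (∀ h : ℤ, h < -1 → F h = F (h + 1) ⊔ bracketSpan (F (h + 1)) (F (-1))) ∧
  (∀ h : ℤ, 0 ≤ h → ∀ X : G, (X ∈ F h ↔ X ∈ F (-1) ∧ ∀ Y ∈ F (-1), ⁅X, Y⁆ ∈ F (h - 1)))

namespace IsCanonicalChain

variable {G : Type*} [LieRing G] [LieAlgebra ℝ G] {l₀ : Submodule ℝ G} {F : ℤ → Submodule ℝ G}

theorem le_pred (hF : IsCanonicalChain l₀ F) (n : ℕ) : F n ≤ F (n - 1) := by
  induction n with
  | zero => exact fun x hx => ((hF.2.2 0 le_rfl x).1 hx).1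
  | succ n ih =>
    intro x hx
    have hx' := (hF.2.2 _ (by positivity) x).1 hx
    have e : ((n + 1 : ℕ) : ℤ) - 1 = n := by push_cast; ring
    rw [e] at hx' ⊢
    exact (hF.2.2 _ (by positivity) x).2 ⟨hx'.1, fun y hy => ih (hx'.2 y hy)⟩

theorem le_add (hF : IsCanonicalChain l₀ F) {k : ℤ} (hk : -1 ≤ k) (n : ℕ) :
    F (k + n) ≤ F k := by
  induction n with
  | zero => simp
  | succ n ih =>
    have h := hF.le_pred (k + n + 1).toNat
    rw [Int.toNat_of_nonneg (by lia), add_sub_cancel_right] at h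
    rw [Nat.cast_succ, ← add_assoc]
    exact h.trans ih

theorem anti (hF : IsCanonicalChain l₀ F) {h k : ℤ} (hk : -1 ≤ k) (hkh : k ≤ h) :
    F h ≤ F k := by
  have := hF.le_add hk (h - k).toNat
  rwa [Int.toNat_of_nonneg (by lia), add_sub_cancel] at this

theorem lie_mem_pred (hF : IsCanonicalChain l₀ F) {h : ℤ} (hh : 0 ≤ h) {x y : G}
    (hx : x ∈ F h) (hy : y ∈ F (-1)) : ⁅x, y⁆ ∈ F (h - 1) :=
  ((hF.2.2 h hh x).1 hx).2 y hy

theorem lie_mem_of_add_eq (hF : IsCanonicalChain l₀ F) (n : ℕ) :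
    ∀ h k : ℤ, -1 ≤ h → -1 ≤ k → h + k = n - 1 →
      ∀ x ∈ F h, ∀ y ∈ F k, ⁅x, y⁆ ∈ F (n - 1) := by
  induction n with
  | zero =>
    intro h k hh hk hs x hx y hy
    obtain ⟨rfl, rfl⟩ | ⟨rfl, rfl⟩ : (h = -1 ∧ k = 0) ∨ (h = 0 ∧ k = -1) := by lia
    · rw [← lie_skew]
      exact neg_mem (hF.lie_mem_pred le_rfl hy hx)
    · exact hF.lie_mem_pred le_rfl hx hy
  | succ n ih =>
    intro h k hh hk hs x hx y hy
    rw [Nat.cast_succ] at hs ⊢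
    obtain rfl | hh := hh.eq_or_lt
    · rw [← lie_skew, ← hs, neg_add_eq_sub]
      exact neg_mem (hF.lie_mem_pred (by lia) hy hx)
    obtain rfl | hk := hk.eq_or_lt
    · rw [← hs]
      exact hF.lie_mem_pred (by lia) hx hy
    refine (hF.2.2 _ (by lia) _).2 ⟨?_, fun z hz => ?_⟩
    · exact hF.anti le_rfl (by lia) (hF.lie_mem_pred (by lia) hx (hF.anti le_rfl hk.le hy))
    · rw [lie_lie, add_sub_cancel_right]
      exact sub_mem
        (ih h (k - 1) hh.le (by lia) (by lia) x hx _ (hF.lie_mem_pred (by lia) hy hz))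
        (ih k (h - 1) hk.le (by lia) (by lia) y hy _ (hF.lie_mem_pred (by lia) hx hz))

/-- The nonnegative part of the canonical chain is compatible with brackets. -/
theorem lie_mem_add (hF : IsCanonicalChain l₀ F) {h k : ℤ} (hh : 0 ≤ h) (hk : 0 ≤ k)
    {x y : G} (hx : x ∈ F h) (hy : y ∈ F k) : ⁅x, y⁆ ∈ F (h + k) := by
  have e : (((h + k + 1).toNat : ℕ) : ℤ) - 1 = h + k := by lia
  simpa only [e] using
    hF.lie_mem_of_add_eq (h + k + 1).toNat h k (by lia) (by lia) e.symm x hx y hy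

end IsCanonicalChain

theorem statement4 {G : Type*} [LieRing G] [LieAlgebra ℝ G]
    (l₀ : Submodule ℝ G)
    (hcodim : FiniteDimensional ℝ (G ⧸ l₀))
    (hgen : LieSubalgebra.lieSpan ℝ G (l₀ : Set G) = ⊤)
    (F : ℤ → Submodule ℝ G) (hF : IsCanonicalChain l₀ F) :
    ∀ h : ℤ, 0 ≤ h → ∀ x ∈ F h, ∀ y ∈ F h, ⁅x, y⁆ ∈ F h := by
  intro h hh x hx y hy
  exact hF.anti (by lia) (by lia) (hF.lie_mem_add hh hh hx hy)
end

section
/- Let $\mathfrak{g}$ be a complex Lie algebra equipped with a conjugation $\sigma$ and $\mathfrak{q}$ a complex Lie subalgebra with $\bar{\mathfrak{q}}=\sigma(\mathfrak{q})$, with the associated chains $(\bar{\mathfrak{q}}^{(h)})_{h\ge 0}$ and $(\tilde{\mathfrak{q}}^{(h)})_{h\ge 0}$. Then for every $h\ge 0$: $\bar{\mathfrak{q}}^{(h+1)}=\bar{\mathfrak{q}}^{(h)}$ if and only if $\tilde{\mathfrak{q}}^{(h+1)}=\tilde{\mathfrak{q}}^{(h)}$; moreover, if $\bar{\mathfrak{q}}^{(h+1)}=\bar{\mathfrak{q}}^{(h)}$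 then $\bar{\mathfrak{q}}^{(r)}=\bar{\mathfrak{q}}^{(h)}$ for all $r\ge h$. In particular the two chains have the same length. -/
/-- `σ` is a conjugation of the complex Lie algebra `G`: an involutive conjugate-linear
map preserving brackets. -/
def IsConjugation {G : Type*} [LieRing G] [LieAlgebra ℂ G] (σ : G → G) : Prop :=
  (∀ x y : G, σ (x + y) = σ x + σ y) ∧
  (∀ (c : ℂ) (x : G), σ (c • x) = (starRingEnd ℂ) c • σ x) ∧
  (∀ x : G, σ (σ x) = x) ∧
  (∀ x y : G, σ ⁅x, y⁆ = ⁅σ x, σ y⁆)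

/-- `Qb, Qt` are the chains `q̄⁽ʰ⁾` and `q̃⁽ʰ⁾` associated to the complex Lie
subalgebra `q` and the conjugation `σ`:  `q̄⁽⁰⁾ = σ(q)`, `q̃⁽ʰ⁾ = q + q̄⁽ʰ⁾`, and
`q̄⁽ʰ⁺¹⁾ = {Z ∈ q̄⁽ʰ⁾ ∣ [Z, q] ⊆ q̃⁽ʰ⁾}`. -/
def IsCRChain {G : Type*} [LieRing G] [LieAlgebra ℂ G] (σ : G → G)
    (q : LieSubalgebra ℂ G) (Qb Qt : ℕ → Submodule ℂ G) : Prop :=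
  ((Qb 0 : Submodule ℂ G) : Set G) = σ '' q ∧
  (∀ h : ℕ, Qt h = q.toSubmodule ⊔ Qb h) ∧
  (∀ h : ℕ, ∀ Z : G, (Z ∈ Qb (h + 1) ↔ Z ∈ Qb h ∧ ∀ W ∈ q, ⁅Z, W⁆ ∈ Qt h))

section

variable {G : Type*} [LieRing G] [LieAlgebra ℂ G] {σ : G → G} {q : LieSubalgebra ℂ G}
  {Qb Qt : ℕ → Submodule ℂ G}

namespace IsCRChain

theorem antitone (hc : IsCRChain σ q Qb Qt) : Antitone Qb :=
  antitone_nat_of_succ_le fun h Z hZ => ((hc.2.2 h Z).1 hZ).1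

/-- The intersection `q ∩ q̄` is contained in every term of the chain `q̄⁽ʰ⁾`. -/
theorem inf_le (hc : IsCRChain σ q Qb Qt) (h : ℕ) : q.toSubmodule ⊓ Qb 0 ≤ Qb h := by
  induction h with
  | zero => exact inf_le_right
  | succ h ih =>
    intro Z hZ
    refine (hc.2.2 h Z).2 ⟨ih hZ, fun W hW => ?_⟩
    rw [hc.2.1 h]
    exact Submodule.mem_sup_left (q.lie_mem hZ.1 hW)

theorem succ_eq_iff (hc : IsCRChain σ q Qb Qt) (h : ℕ) :
    Qb (h + 1) = Qb h ↔ Qt (h + 1) = Qt h := by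
  refine ⟨fun e => by rw [hc.2.1, hc.2.1, e], fun e => ?_⟩
  refine le_antisymm (hc.antitone h.le_succ) fun Z hZ => ?_
  have hZt : Z ∈ q.toSubmodule ⊔ Qb (h + 1) := by
    rw [← hc.2.1, e, hc.2.1]
    exact Submodule.mem_sup_right hZ
  obtain ⟨W, hW, Y, hY, rfl⟩ := Submodule.mem_sup.1 hZt
  have hWb : W ∈ Qb h :=
    ((Qb h).add_mem_iff_left (hc.antitone h.le_succ hY)).1 hZ
  exact add_mem (hc.inf_le (h + 1) ⟨hW, hc.antitone h.zero_le hWb⟩) hY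

theorem eq_of_succ_eq (hc : IsCRChain σ q Qb Qt) {h : ℕ} (e : Qb (h + 1) = Qb h)
    {r : ℕ} (hr : h ≤ r) : Qb r = Qb h := by
  induction r, hr using Nat.le_induction with
  | base => rfl
  | succ r _ ih =>
    rw [← e]
    ext Z
    rw [hc.2.2, hc.2.2, hc.2.1, hc.2.1, ih]

end IsCRChain

end

theorem statement12 {G : Type*} [LieRing G] [LieAlgebra ℂ G]
    (σ : G → G) (hσ : IsConjugation σ)
    (q : LieSubalgebra ℂ G) (Qb Qt : ℕ → Submodule ℂ G)
    (hc : IsCRChain σ q Qb Qt) :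
    ∀ h : ℕ, (Qb (h + 1) = Qb h ↔ Qt (h + 1) = Qt h) ∧
      (Qb (h + 1) = Qb h → ∀ r : ℕ, h ≤ r → Qb r = Qb h) := by
  exact fun h => ⟨hc.succ_eq_iff h, fun e _ hr => hc.eq_of_succ_eq e hr⟩
end
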